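/- arXiv:2206.09342 — 2 statements merged into one kernel-verified Lean document; each statement's English description precedes it below -/
import Mathlib

section
/- Fix ε > 0, κ > 0, m ≥ 2, U3 ∈ ℝ and a1, a2 ∈ ℝ. On {x ∈ ℝ³ : x' ≠ 0} define δ(x') = ε + 2κ|x'|^m, G(x) = x3/δ(x'), x'·∇'δ = 2κm|x'|^m, and v(x) = U3[(1/2 + G)e₃ + (G² − 1/4)((a1 x1/δ)e₁ + (a1 x2/δ)e₂ + G(a1(x'·∇'δ)/δ + a2)e₃)]. Then at every such point, div v(x) = U3[(1 − (2a1 + a2)/4) + (2a1 + 3a2)G(x)²]/δ(x'). In particular, div v ≡ 0 when a1 = 3 and a2 = −2. -/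
/-- Gap width `δ(x') = ε + 2κ|x'|^m`. -/
noncomputable def δf (ε κ m x1 x2 : ℝ) : ℝ := ε + 2 * κ * Real.sqrt (x1 ^ 2 + x2 ^ 2) ^ m

/-- Ansatz for the squeeze-motion approximate velocity with undetermined
coefficients `a1, a2`:
`v = U3[(1/2+G)e₃ + (G²−1/4)((a1x₁/δ)e₁ + (a1x₂/δ)e₂ + G(a1(x'·∇'δ)/δ + a2)e₃)]`,
where `G = x₃/δ` and `x'·∇'δ = 2κm|x'|^m`. -/
noncomputable def v5 (ε κ m U3 a1 a2 : ℝ) (x1 x2 x3 : ℝ) : Fin 3 → ℝ :=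
  ![U3 * (((x3 / δf ε κ m x1 x2) ^ 2 - 1 / 4) * (a1 * x1 / δf ε κ m x1 x2)),
    U3 * (((x3 / δf ε κ m x1 x2) ^ 2 - 1 / 4) * (a1 * x2 / δf ε κ m x1 x2)),
    U3 * ((1 / 2 + x3 / δf ε κ m x1 x2) +
      ((x3 / δf ε κ m x1 x2) ^ 2 - 1 / 4) * (x3 / δf ε κ m x1 x2) *
        (a1 * (2 * κ * m * Real.sqrt (x1 ^ 2 + x2 ^ 2) ^ m) / δf ε κ m x1 x2 + a2))]

/-- The divergence `∂₁v₁ + ∂₂v₂ + ∂₃v₃`. -/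
noncomputable def div3 (v : ℝ → ℝ → ℝ → Fin 3 → ℝ) (x1 x2 x3 : ℝ) : ℝ :=
  deriv (fun t => v t x2 x3 0) x1 + deriv (fun t => v x1 t x3 1) x2 +
    deriv (fun t => v x1 x2 t 2) x3

theorem δf_pos {ε κ : ℝ} (hε : 0 < ε) (hκ : 0 < κ) (m x1 x2 : ℝ) : 0 < δf ε κ m x1 x2 := by
  unfold δf
  positivity

theorem δf_comm (ε κ m x1 x2 : ℝ) : δf ε κ m x1 x2 = δf ε κ m x2 x1 := by
  unfold δf
  rw [add_comm (x1 ^ 2)]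

/-- The partial derivative `∂₁δ = 2κm|x'|^(m-2) x₁`, with `|x'|^(m-2)` written as a quotient. -/
theorem hasDerivAt_δf (ε κ m : ℝ) {x1 x2 : ℝ} (h : 0 < x1 ^ 2 + x2 ^ 2) :
    HasDerivAt (fun t => δf ε κ m t x2)
      (2 * κ * m * (Real.sqrt (x1 ^ 2 + x2 ^ 2) ^ m / (x1 ^ 2 + x2 ^ 2)) * x1) x1 := by
  have hs : 0 < Real.sqrt (x1 ^ 2 + x2 ^ 2) := Real.sqrt_pos.2 h
  have hq : HasDerivAt (fun t : ℝ => t ^ 2 + x2 ^ 2) (2 * x1) x1 := by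
    simpa using (hasDerivAt_pow 2 x1).add_const (x2 ^ 2)
  have hd := (((hq.sqrt h.ne').rpow_const (p := m) (Or.inl hs.ne')).const_mul (2 * κ)).const_add ε
  refine hd.congr_deriv ?_
  have hsq := Real.sq_sqrt h.le
  rw [Real.rpow_sub_one hs.ne']
  generalize Real.sqrt (x1 ^ 2 + x2 ^ 2) = s at *
  rw [← hsq]
  field_simp

/-- Derivative of a horizontal component of the ansatz along its own coordinate. -/
theorem hasDerivAt_horizontal {d : ℝ → ℝ} {d' t : ℝ} (hd : HasDerivAt d d' t) (h0 : d t ≠ 0)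
    (U a z : ℝ) :
    HasDerivAt (fun s => U * (((z / d s) ^ 2 - 1 / 4) * (a * s / d s)))
      (U * a * (((z / d t) ^ 2 - 1 / 4) / d t
        - (3 * (z / d t) ^ 2 - 1 / 4) * (t * d') / d t ^ 2)) t := by
  have hG := (((hasDerivAt_const t z).div hd h0).pow 2).sub_const (1 / 4)
  have hx := ((hasDerivAt_id t).const_mul a).div hd h0
  refine ((hG.mul hx).const_mul U).congr_deriv ?_
  simp only [Pi.div_apply, Pi.pow_apply, id_eq, Nat.add_one_sub_one, pow_one]
  field_simp
  ring

/-- Derivative of the vertical component of the ansatz in the vertical coordinate. -/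
theorem hasDerivAt_vertical (U d b z : ℝ) :
    HasDerivAt (fun s => U * ((1 / 2 + s / d) + ((s / d) ^ 2 - 1 / 4) * (s / d) * b))
      (U * (1 / d + (3 * (z / d) ^ 2 - 1 / 4) / d * b)) z := by
  have hG := (hasDerivAt_id z).div_const d
  refine (((hG.const_add (1 / 2)).add
    ((((hG.pow 2).sub_const (1 / 4)).mul hG).mul_const b)).const_mul U).congr_deriv ?_
  simp only [Pi.pow_apply, id_eq]
  ring

theorem div3_v5 {ε κ : ℝ} (hε : 0 < ε) (hκ : 0 < κ) (m U3 a1 a2 : ℝ) {x1 x2 : ℝ} (x3 : ℝ)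
    (hx : (x1, x2) ≠ (0, 0)) :
    div3 (v5 ε κ m U3 a1 a2) x1 x2 x3
      = U3 * ((1 - (2 * a1 + a2) / 4)
          + (2 * a1 + 3 * a2) * (x3 / δf ε κ m x1 x2) ^ 2) / δf ε κ m x1 x2 := by
  have hq : 0 < x1 ^ 2 + x2 ^ 2 := by
    by_contra! hle
    have h1 : x1 = 0 := by nlinarith [sq_nonneg x1, sq_nonneg x2]
    have h2 : x2 = 0 := by nlinarith [sq_nonneg x1, sq_nonneg x2]
    exact hx (by rw [h1, h2])
  have hδ := (δf_pos hε hκ m x1 x2).ne'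
  have hd2 : HasDerivAt (fun t => δf ε κ m x1 t)
      (2 * κ * m * (Real.sqrt (x1 ^ 2 + x2 ^ 2) ^ m / (x1 ^ 2 + x2 ^ 2)) * x2) x2 := by
    have := hasDerivAt_δf ε κ m (x1 := x2) (x2 := x1) (by rwa [add_comm])
    simpa only [δf_comm ε κ m _ x1, add_comm (x2 ^ 2)] using this
  have e1 := (hasDerivAt_horizontal (hasDerivAt_δf ε κ m hq) hδ U3 a1 x3).deriv
  have e2 := (hasDerivAt_horizontal hd2 hδ U3 a1 x3).deriv
  have e3 := (hasDerivAt_vertical U3 (δf ε κ m x1 x2)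
    (a1 * (2 * κ * m * Real.sqrt (x1 ^ 2 + x2 ^ 2) ^ m) / δf ε κ m x1 x2 + a2) x3).deriv
  simp only [div3, v5, Matrix.cons_val]
  rw [e1, e2, e3]
  generalize δf ε κ m x1 x2 = d at *
  generalize Real.sqrt (x1 ^ 2 + x2 ^ 2) ^ m = P
  have hq' := hq.ne'
  field_simp
  ring

/-- `div v = U3[(1 − (2a1+a2)/4) + (2a1+3a2)G²]/δ`; in particular `div v ≡ 0`
when `a1 = 3` and `a2 = −2`. -/
theorem stmt5 (ε κ m U3 a1 a2 : ℝ) (hε : 0 < ε) (hκ : 0 < κ) (hm : 2 ≤ m) :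
    (∀ x1 x2 x3 : ℝ, (x1, x2) ≠ (0, 0) →
      div3 (v5 ε κ m U3 a1 a2) x1 x2 x3
        = U3 * ((1 - (2 * a1 + a2) / 4)
            + (2 * a1 + 3 * a2) * (x3 / δf ε κ m x1 x2) ^ 2) / δf ε κ m x1 x2) ∧
    (a1 = 3 → a2 = -2 → ∀ x1 x2 x3 : ℝ, (x1, x2) ≠ (0, 0) →
      div3 (v5 ε κ m U3 a1 a2) x1 x2 x3 = 0) := by
  refine ⟨fun x1 x2 x3 hx => div3_v5 hε hκ m U3 a1 a2 x3 hx, ?_⟩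
  rintro rfl rfl x1 x2 x3 hx
  rw [div3_v5 hε hκ m U3 _ _ x3 hx]
  norm_num
end

section
/- Fix ε > 0, κ > 0, μ > 0, take m = 2 (so δ(x') = ε + 2κ|x'|², x'·∇'δ = 4κ|x'|²), fix ω1, ω2 ∈ ℝ, and set b1 = −12/5, b2 = 3/(10κ), b3 = 16/5, b4 = 3/(5κ). Let w(x') = ω1x2 − ω2x1, K(x') = b1(x'·∇'δ)/δ + b3, G(x) = x3/δ(x'), and define ū⁽⁴⁾(x) = w(1/2 + G)e₃ + (G² − 1/4)[(−b1x1w/δ + b2ω2)e₁ + (−b1x2w/δ − b2ω1)e₂ − w·K·G e₃] and p̄⁽⁴⁾(x) = −μ w δ^{−2}[3x3² K/δ + b4]. Then for every x ∈ ℝ³: μ ∂₃₃ū⁽⁴⁾ᵢ(x) − ∂ᵢ p̄⁽⁴⁾(x) = 3μ x3² ∂ᵢ[w K δ^{−3}](x') for i = 1, 2, and μ ∂₃₃ū⁽⁴⁾₃(x) − ∂₃ p̄⁽⁴⁾(x) = 0. -/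
/-- Gap width for `m = 2`: `δ(x') = ε + 2κ|x'|²`. -/
noncomputable def δ2 (ε κ x1 x2 : ℝ) : ℝ := ε + 2 * κ * (x1 ^ 2 + x2 ^ 2)

/-- `w(x') = ω1x₂ − ω2x₁`. -/
noncomputable def wf (ω1 ω2 x1 x2 : ℝ) : ℝ := ω1 * x2 - ω2 * x1

/-- `K(x') = b1(x'·∇'δ)/δ + b3` with `x'·∇'δ = 4κ|x'|²`. -/
noncomputable def K4 (ε κ b1 b3 x1 x2 : ℝ) : ℝ :=
  b1 * (4 * κ * (x1 ^ 2 + x2 ^ 2)) / δ2 ε κ x1 x2 + b3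

/-- The rotation-induced squeeze pressure `p̄⁽⁴⁾ = −μwδ^{−2}[3x₃²K/δ + b4]`. -/
noncomputable def p4 (ε κ μ ω1 ω2 b1 b3 b4 x1 x2 x3 : ℝ) : ℝ :=
  -(μ * wf ω1 ω2 x1 x2) / (δ2 ε κ x1 x2) ^ 2
    * (3 * x3 ^ 2 * K4 ε κ b1 b3 x1 x2 / δ2 ε κ x1 x2 + b4)

theorem deriv_deriv_sq_div_sub_mul (d k c x : ℝ) :
    deriv (fun t => deriv (fun s => ((s / d) ^ 2 - k) * c) t) x = 2 * c / d ^ 2 := by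
  have h : ∀ t, deriv (fun s => ((s / d) ^ 2 - k) * c) t = t * (2 * c / d ^ 2) := fun t => by
    refine ((((((hasDerivAt_id' t).div_const d).pow 2).sub_const k).mul_const c).congr_deriv
      ?_).deriv
    push_cast
    ring
  simp_rw [h]
  exact (((hasDerivAt_id' x).mul_const _).congr_deriv (one_mul _)).deriv

theorem deriv_deriv_cubic_profile (w d k K x : ℝ) :
    deriv (fun t => deriv
      (fun s => w * (1 / 2 + s / d) - ((s / d) ^ 2 - k) * w * K * (s / d)) t) x
      = -(6 * x * w * K / d ^ 3) := by
  have h : ∀ t, deriv (fun s => w * (1 / 2 + s / d) - ((s / d) ^ 2 - k) * w * K * (s / d)) t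
      = w / d + k * w * K / d - t ^ 2 * (3 * w * K / d ^ 3) := fun t => by
    have hG := (hasDerivAt_id' t).div_const d
    refine (((hG.const_add (1 / 2)).const_mul w).sub
      (((((hG.pow 2).sub_const k).mul_const w).mul_const K).mul hG) |>.congr_deriv ?_).deriv
    simp only [Pi.pow_apply]
    push_cast
    ring
  simp_rw [h]
  refine ((((hasDerivAt_id' x).pow 2).mul_const _).const_sub _ |>.congr_deriv ?_).deriv
  push_cast
  ring

theorem δ2_pos {ε κ : ℝ} (hε : 0 < ε) (hκ : 0 < κ) (x1 x2 : ℝ) : 0 < δ2 ε κ x1 x2 := by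
  unfold δ2
  positivity

theorem p4_eq (ε κ μ ω1 ω2 b1 b3 b4 x1 x2 x3 : ℝ) :
    p4 ε κ μ ω1 ω2 b1 b3 b4 x1 x2 x3
      = -(3 * μ * x3 ^ 2) * (wf ω1 ω2 x1 x2 * K4 ε κ b1 b3 x1 x2 / δ2 ε κ x1 x2 ^ 3)
        - μ * b4 * (wf ω1 ω2 x1 x2 / δ2 ε κ x1 x2 ^ 2) := by
  unfold p4
  ring

theorem hasDerivAt_δ2_fst (ε κ x1 x2 : ℝ) :
    HasDerivAt (fun t => δ2 ε κ t x2) (4 * κ * x1) x1 := by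
  unfold δ2
  refine (((((hasDerivAt_id' x1).pow 2).add_const (x2 ^ 2)).const_mul (2 * κ)).const_add
    ε).congr_deriv ?_
  push_cast
  ring

theorem δ2_comm (ε κ x1 x2 : ℝ) : δ2 ε κ x1 x2 = δ2 ε κ x2 x1 := by
  unfold δ2
  ring

theorem hasDerivAt_δ2_snd (ε κ x1 x2 : ℝ) :
    HasDerivAt (fun t => δ2 ε κ x1 t) (4 * κ * x2) x2 := by
  simpa only [δ2_comm ε κ x1] using hasDerivAt_δ2_fst ε κ x2 x1

theorem hasDerivAt_wf_fst (ω1 ω2 x1 x2 : ℝ) :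
    HasDerivAt (fun t => wf ω1 ω2 t x2) (-ω2) x1 := by
  unfold wf
  exact (((hasDerivAt_id' x1).const_mul ω2).const_sub (ω1 * x2)).congr_deriv (by ring)

theorem hasDerivAt_wf_snd (ω1 ω2 x1 x2 : ℝ) :
    HasDerivAt (fun t => wf ω1 ω2 x1 t) ω1 x2 := by
  unfold wf
  exact (((hasDerivAt_id' x2).const_mul ω1).sub_const (ω2 * x1)).congr_deriv (by ring)

theorem differentiableAt_K4_fst {ε κ : ℝ} (b1 b3 : ℝ) {x1 x2 : ℝ} (h : δ2 ε κ x1 x2 ≠ 0) :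
    DifferentiableAt ℝ (fun t => K4 ε κ b1 b3 t x2) x1 := by
  unfold K4
  exact (DifferentiableAt.fun_div (by fun_prop)
    (hasDerivAt_δ2_fst ε κ x1 x2).differentiableAt h).add_const _

theorem differentiableAt_K4_snd {ε κ : ℝ} (b1 b3 : ℝ) {x1 x2 : ℝ} (h : δ2 ε κ x1 x2 ≠ 0) :
    DifferentiableAt ℝ (fun t => K4 ε κ b1 b3 x1 t) x2 := by
  unfold K4
  exact (DifferentiableAt.fun_div (by fun_prop)
    (hasDerivAt_δ2_snd ε κ x1 x2).differentiableAt h).add_const _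

/-- Derivative of a combination `a·(wK/δ³) − c·(w/δ²)` along a line. -/
theorem deriv_pressure_combination {w K d : ℝ → ℝ} {w' d' x : ℝ} (a c : ℝ)
    (hw : HasDerivAt w w' x) (hK : DifferentiableAt ℝ K x) (hd : HasDerivAt d d' x)
    (h0 : d x ≠ 0) :
    deriv (fun t => a * (w t * K t / d t ^ 3) - c * (w t / d t ^ 2)) x
      = a * deriv (fun t => w t * K t / d t ^ 3) x
        - c * (w' / d x ^ 2 - 2 * w x * d' / d x ^ 3) := by
  have hf : DifferentiableAt ℝ (fun t => w t * K t / d t ^ 3) x :=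
    (hw.differentiableAt.fun_mul hK).fun_div (hd.differentiableAt.fun_pow 3) (pow_ne_zero 3 h0)
  have hg : HasDerivAt (fun t => w t / d t ^ 2) (w' / d x ^ 2 - 2 * w x * d' / d x ^ 3) x := by
    refine (hw.fun_div (hd.fun_pow 2) (pow_ne_zero 2 h0)).congr_deriv ?_
    push_cast
    field_simp
  exact ((hf.hasDerivAt.const_mul a).sub (hg.const_mul c)).deriv

/-- For the explicit rotation-induced squeeze pair
`ū⁽⁴⁾ = w(1/2+G)e₃ + (G²−1/4)[(−b1x₁w/δ + b2ω2)e₁ + (−b1x₂w/δ − b2ω1)e₂ − wKG e₃]`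
and `p̄⁽⁴⁾` (with `b1 = −12/5`, `b2 = 3/(10κ)`, `b3 = 16/5`, `b4 = 3/(5κ)`), one has
`μ∂₃₃ū⁽⁴⁾ᵢ − ∂ᵢp̄⁽⁴⁾ = 3μx₃²∂ᵢ[wKδ^{−3}]` for `i = 1,2`, and
`μ∂₃₃ū⁽⁴⁾₃ − ∂₃p̄⁽⁴⁾ = 0`. -/
theorem stmt10 (ε κ μ ω1 ω2 b1 b2 b3 b4 : ℝ) (hε : 0 < ε) (hκ : 0 < κ) (hμ : 0 < μ)
    (hb1 : b1 = -12 / 5) (hb2 : b2 = 3 / (10 * κ)) (hb3 : b3 = 16 / 5)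
    (hb4 : b4 = 3 / (5 * κ)) :
    ∀ x1 x2 x3 : ℝ,
      (μ * deriv (fun t => deriv
            (fun s => ((s / δ2 ε κ x1 x2) ^ 2 - 1 / 4)
              * (-(b1 * x1 * wf ω1 ω2 x1 x2) / δ2 ε κ x1 x2 + b2 * ω2)) t) x3
          - deriv (fun t => p4 ε κ μ ω1 ω2 b1 b3 b4 t x2 x3) x1
        = 3 * μ * x3 ^ 2
            * deriv (fun t => wf ω1 ω2 t x2 * K4 ε κ b1 b3 t x2 / (δ2 ε κ t x2) ^ 3) x1) ∧
      (μ * deriv (fun t => deriv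
            (fun s => ((s / δ2 ε κ x1 x2) ^ 2 - 1 / 4)
              * (-(b1 * x2 * wf ω1 ω2 x1 x2) / δ2 ε κ x1 x2 - b2 * ω1)) t) x3
          - deriv (fun t => p4 ε κ μ ω1 ω2 b1 b3 b4 x1 t x3) x2
        = 3 * μ * x3 ^ 2
            * deriv (fun t => wf ω1 ω2 x1 t * K4 ε κ b1 b3 x1 t / (δ2 ε κ x1 t) ^ 3) x2) ∧
      (μ * deriv (fun t => deriv
            (fun s => wf ω1 ω2 x1 x2 * (1 / 2 + s / δ2 ε κ x1 x2)
              - ((s / δ2 ε κ x1 x2) ^ 2 - 1 / 4) * wf ω1 ω2 x1 x2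
                  * K4 ε κ b1 b3 x1 x2 * (s / δ2 ε κ x1 x2)) t) x3
          - deriv (fun t => p4 ε κ μ ω1 ω2 b1 b3 b4 x1 x2 t) x3 = 0) := by
  intro x1 x2 x3
  have h0 := (δ2_pos hε hκ x1 x2).ne'
  refine ⟨?_, ?_, ?_⟩
  · rw [deriv_deriv_sq_div_sub_mul]
    simp_rw [p4_eq]
    rw [deriv_pressure_combination _ _ (hasDerivAt_wf_fst ω1 ω2 x1 x2)
      (differentiableAt_K4_fst b1 b3 h0) (hasDerivAt_δ2_fst ε κ x1 x2) h0]
    subst hb1 hb2 hb4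
    field_simp
    ring
  · rw [deriv_deriv_sq_div_sub_mul]
    simp_rw [p4_eq]
    rw [deriv_pressure_combination _ _ (hasDerivAt_wf_snd ω1 ω2 x1 x2)
      (differentiableAt_K4_snd b1 b3 h0) (hasDerivAt_δ2_snd ε κ x1 x2) h0]
    subst hb1 hb2 hb4
    field_simp
    ring
  · rw [deriv_deriv_cubic_profile]
    have hp : HasDerivAt (fun t => p4 ε κ μ ω1 ω2 b1 b3 b4 x1 x2 t)
        (-(6 * μ * x3 * wf ω1 ω2 x1 x2 * K4 ε κ b1 b3 x1 x2 / δ2 ε κ x1 x2 ^ 3)) x3 := by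
      unfold p4
      refine ((((((((hasDerivAt_id' x3).fun_pow 2).const_mul 3).mul_const _).div_const
        _).add_const b4).const_mul _)).congr_deriv ?_
      push_cast
      field_simp
      ring
    rw [hp.deriv]
    ring
end
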